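/- arXiv:1312.7155 — 2 statements merged into one kernel-verified Lean document; each statement's English description precedes it below -/
import Mathlib

section
/- The cutting operation is jointly continuous: for a topological space B, the map sending a triple ((γ, r), a, b) with (γ, r) a Moore path on B and 0 ≤ a < b to the cut Moore path (γ_{[a,b]}, b − a) is continuous, where the Moore path space carries the subspace topology of C([0,∞), B) × [0,∞) with the compact-open topology on C([0,∞), B). -/
open scoped NNReal

/-- A Moore path on `B` of length `r`: a continuous `γ : [0,∞) → B`
with `γ t = γ r` for all `t ≥ r`. -/
def IsMoore {B : Type*} [TopologicalSpace B] (γ : ℝ≥0 → B) (r : ℝ≥0) : Prop :=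
  Continuous γ ∧ ∀ t, r ≤ t → γ t = γ r

/-- Juxtaposition of Moore paths: `(γ₁·γ₂)(t) = γ₁ t` for `t ≤ r₁` and
`(γ₁·γ₂)(t) = γ₂ (t - r₁)` for `t ≥ r₁`. -/
noncomputable def juxt {B : Type*} (γ₁ γ₂ : ℝ≥0 → B) (r₁ : ℝ≥0) : ℝ≥0 → B :=
  fun t => if t ≤ r₁ then γ₁ t else γ₂ (t - r₁)

/-- The cutting operation on Moore paths: `γ_{[a,b]}(t) = γ (t + a)` for
`t ≤ b - a` and `γ_{[a,b]}(t) = γ b` for `t ≥ b - a`. -/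
noncomputable def cut {B : Type*} (γ : ℝ≥0 → B) (a b : ℝ≥0) : ℝ≥0 → B :=
  fun t => if t ≤ b - a then γ (t + a) else γ b

theorem cut_continuous {B : Type*} [TopologicalSpace B] {γ : ℝ≥0 → B} {a b : ℝ≥0}
    (h : Continuous γ) (hab : a ≤ b) : Continuous (cut γ a b) := by
  unfold cut
  refine Continuous.if_le (h.comp (continuous_id.add continuous_const)) continuous_const
    continuous_id continuous_const ?_
  intro t ht
  subst ht
  rw [tsub_add_cancel_of_le hab]

theorem cut_const_after {B : Type*} {γ : ℝ≥0 → B} {a b : ℝ≥0} (hab : a ≤ b) :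
    ∀ t, b - a ≤ t → cut γ a b t = cut γ a b (b - a) := by
  intro t ht
  unfold cut
  by_cases hle : t ≤ b - a
  · have heq : t = b - a := le_antisymm hle ht
    simp [heq]
  · simp [hle, tsub_add_cancel_of_le hab]

/-- The Moore path space `P_M(B)`, topologized as a subspace of
`C([0,∞), B) × [0,∞)` with the compact-open topology on `C([0,∞), B)`. -/
abbrev MoorePathSpace (B : Type*) [TopologicalSpace B] : Type _ :=
  {p : C(ℝ≥0, B) × ℝ≥0 // ∀ t, p.2 ≤ t → p.1 t = p.1 p.2}

/-- The cutting operation `((γ, r), (a, b)) ↦ (γ_{[a,b]}, b - a)` for `a < b`,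
as a map on the Moore path space. -/
noncomputable def cutMap {B : Type*} [TopologicalSpace B]
    (p : MoorePathSpace B) (ab : {x : ℝ≥0 × ℝ≥0 // x.1 < x.2}) : MoorePathSpace B :=
  ⟨(⟨cut (⇑p.1.1) ab.1.1 ab.1.2, cut_continuous p.1.1.continuous ab.2.le⟩,
    ab.1.2 - ab.1.1), cut_const_after ab.2.le⟩

theorem cut_eq_min {B : Type*} (γ : ℝ≥0 → B) {a b : ℝ≥0} (hab : a ≤ b) (t : ℝ≥0) :
    cut γ a b t = γ (min (t + a) b) := by
  unfold cut
  split_ifs with h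
  · rw [min_eq_left ((le_tsub_iff_right hab).1 h)]
  · rw [min_eq_right (le_of_not_ge fun hn => h ((le_tsub_iff_right hab).2 hn))]

/-- the cutting operation is jointly continuous: the map sending a
triple `((γ, r), a, b)` with `(γ, r)` a Moore path and `a < b` to the cut Moore
path `(γ_{[a,b]}, b − a)` is continuous. -/
theorem cutMap_continuous {B : Type*} [TopologicalSpace B] :
    Continuous (fun x : MoorePathSpace B × {x : ℝ≥0 × ℝ≥0 // x.1 < x.2} =>
      cutMap x.1 x.2) := by
  refine Continuous.subtype_mk (Continuous.prodMk ?_ (by fun_prop)) _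
  refine ContinuousMap.continuous_of_continuous_uncurry _ ?_
  change Continuous fun y : (MoorePathSpace B × {x : ℝ≥0 × ℝ≥0 // x.1 < x.2}) × ℝ≥0 =>
    cut (⇑y.1.1.1.1) y.1.2.1.1 y.1.2.1.2 y.2
  simp_rw [fun y : (MoorePathSpace B × {x : ℝ≥0 × ℝ≥0 // x.1 < x.2}) × ℝ≥0 =>
    cut_eq_min (⇑y.1.1.1.1) y.1.2.2.le y.2]
  fun_prop
end

section
/- Concatenation parameters of the form x_{c;a,b} satisfy the coherence relation: for a topological space Y, continuous maps α₁, α₂, α₃ : [0,1] → Y with α₁(1) = α₂(0) and α₂(1) = α₃(0), and real numbers 0 < a₁ < a₂ < a₃ < c, one has (α₁ *^{x_{c;a₁,a₂}} α₂) *^{x_{c;a₂,a₃}} α₃ = α₁ *^{x_{c;a₁,a₃}} α₂ *^{x_{c;a₂,a₃}} α₃ = α₁ *^{x_{c;a₁,a₃}} (α₂ *^{x_{c−a₁;a₂−a₁,a₃−a₁}} α₃) as maps [0,1] → Y, where x_{c;a,b} := a(c−b)/(b(c−a)). -/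
open unitInterval

/-- The concatenation-with-parameter `α₁ *^a α₂` of two paths `α₁ α₂ : [0,1] → Y`:
`(α₁ *^a α₂)(u) = α₁(u/a)` for `0 ≤ u ≤ a` and `(α₁ *^a α₂)(u) = α₂((u−a)/(1−a))`
for `a ≤ u ≤ 1`. -/
noncomputable def concatP {Y : Type*} (α₁ α₂ : unitInterval → Y) (a : ℝ) :
    unitInterval → Y :=
  fun u => if (u : ℝ) ≤ a then α₁ (Set.projIcc 0 1 zero_le_one ((u : ℝ) / a))
           else α₂ (Set.projIcc 0 1 zero_le_one (((u : ℝ) - a) / (1 - a)))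

/-- The three-fold concatenation-with-parameters `α₁ *^a α₂ *^b α₃`:
it equals `α₁(u/a)` for `0 ≤ u ≤ a`, `α₂((u−a)/(b−a))` for `a ≤ u ≤ b`, and
`α₃((u−b)/(1−b))` for `b ≤ u ≤ 1`. -/
noncomputable def concat₃ {Y : Type*} (α₁ α₂ α₃ : unitInterval → Y) (a b : ℝ) :
    unitInterval → Y :=
  fun u => if (u : ℝ) ≤ a then α₁ (Set.projIcc 0 1 zero_le_one ((u : ℝ) / a))
           else if (u : ℝ) ≤ b then α₂ (Set.projIcc 0 1 zero_le_one (((u : ℝ) - a) / (b - a)))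
           else α₃ (Set.projIcc 0 1 zero_le_one (((u : ℝ) - b) / (1 - b)))

/-- The concatenation parameter `x_{c;a,b} := a(c−b)/(b(c−a))`. -/
noncomputable def xpar (c a b : ℝ) : ℝ := a * (c - b) / (b * (c - a))

theorem concatP_concatP_left {Y : Type*} (α₁ α₂ α₃ : unitInterval → Y) {a b : ℝ}
    (ha : a ≤ 1) (hb : 0 < b) :
    concatP (concatP α₁ α₂ a) α₃ b = concat₃ α₁ α₂ α₃ (a * b) b := by
  funext u
  have hu := u.2.1
  unfold concatP concat₃
  by_cases hub : (u : ℝ) ≤ b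
  · have hmem : (u : ℝ) / b ∈ Set.Icc (0 : ℝ) 1 :=
      ⟨div_nonneg hu hb.le, (div_le_one hb).2 hub⟩
    have e₁ : (u : ℝ) / b / a = u / (a * b) := by rw [div_div, mul_comm]
    have e₂ : ((u : ℝ) / b - a) / (1 - a) = (u - a * b) / (b - a * b) := by
      rw [← mul_div_mul_right _ (1 - a) hb.ne']
      congr 1
      · field_simp
      · ring
    simp only [hub, if_true, Set.projIcc_of_mem zero_le_one hmem, div_le_iff₀ hb, e₁, e₂]
  · have hab : ¬ (u : ℝ) ≤ a * b := fun h => hub (h.trans (mul_le_of_le_one_left hb.le ha))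
    simp only [hub, hab, if_false]

theorem concatP_concatP_right {Y : Type*} (α₁ α₂ α₃ : unitInterval → Y) {a b : ℝ}
    (ha : a < 1) :
    concatP α₁ (concatP α₂ α₃ ((b - a) / (1 - a))) a = concat₃ α₁ α₂ α₃ a b := by
  funext u
  have hu := u.2.2
  have ha' : 0 < 1 - a := sub_pos.2 ha
  unfold concatP concat₃
  by_cases hua : (u : ℝ) ≤ a
  · simp only [hua, if_true]
  · have hmem : ((u : ℝ) - a) / (1 - a) ∈ Set.Icc (0 : ℝ) 1 :=
      ⟨div_nonneg (by linarith) ha'.le, (div_le_one ha').2 (by linarith)⟩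
    have e₁ : ((u : ℝ) - a) / (1 - a) / ((b - a) / (1 - a)) = (u - a) / (b - a) :=
      div_div_div_cancel_right₀ ha'.ne' _ _
    have e₂ : (((u : ℝ) - a) / (1 - a) - (b - a) / (1 - a)) / (1 - (b - a) / (1 - a)) =
        (u - b) / (1 - b) := by
      rw [← sub_div, one_sub_div ha'.ne', div_div_div_cancel_right₀ ha'.ne']
      congr 1 <;> ring
    simp only [hua, if_false, Set.projIcc_of_mem zero_le_one hmem, e₁, e₂,
      div_le_div_iff_of_pos_right ha', sub_le_sub_iff_right]

theorem xpar_pos {c a b : ℝ} (ha : 0 < a) (hab : a < b) (hbc : b < c) : 0 < xpar c a b :=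
  div_pos (mul_pos ha (sub_pos.2 hbc))
    (mul_pos (ha.trans hab) (sub_pos.2 (hab.trans hbc)))

theorem xpar_lt_one {c a b : ℝ} (ha : 0 < a) (hab : a < b) (hbc : b < c) : xpar c a b < 1 := by
  rw [xpar, div_lt_one (mul_pos (ha.trans hab) (sub_pos.2 (hab.trans hbc)))]
  nlinarith [mul_pos (sub_pos.2 hab) ((ha.trans hab).trans hbc)]

theorem xpar_mul_xpar {c a₁ a₂ a₃ : ℝ} (ha₂ : a₂ ≠ 0) (hc : c ≠ a₂) :
    xpar c a₁ a₂ * xpar c a₂ a₃ = xpar c a₁ a₃ := by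
  have hc' : c - a₂ ≠ 0 := sub_ne_zero.2 hc
  unfold xpar
  rw [div_mul_div_comm, ← mul_div_mul_right (a₁ * (c - a₃)) _ (mul_ne_zero ha₂ hc')]
  congr 1 <;> ring

theorem xpar_sub_div_one_sub {c a₁ a₂ a₃ : ℝ} (h0 : 0 < a₁) (h12 : a₁ < a₂) (h23 : a₂ < a₃)
    (h3c : a₃ < c) :
    (xpar c a₂ a₃ - xpar c a₁ a₃) / (1 - xpar c a₁ a₃) =
      xpar (c - a₁) (a₂ - a₁) (a₃ - a₁) := by
  have hne : 1 - xpar c a₁ a₃ ≠ 0 :=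
    (sub_pos.2 (xpar_lt_one h0 (h12.trans h23) h3c)).ne'
  have n₁ : a₃ ≠ 0 := by linarith
  have n₂ : c - a₁ ≠ 0 := by linarith
  have n₃ : c - a₂ ≠ 0 := by linarith
  have n₄ : a₃ - a₁ ≠ 0 := by linarith
  rw [div_eq_iff hne]
  simp only [xpar, sub_sub_sub_cancel_right]
  field_simp
  ring

/-- coherence of concatenation parameters of the form `x_{c;a,b}`:
for `0 < a₁ < a₂ < a₃ < c`,
`(α₁ *^{x_{c;a₁,a₂}} α₂) *^{x_{c;a₂,a₃}} α₃ = α₁ *^{x_{c;a₁,a₃}} α₂ *^{x_{c;a₂,a₃}} α₃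
 = α₁ *^{x_{c;a₁,a₃}} (α₂ *^{x_{c−a₁;a₂−a₁,a₃−a₁}} α₃)`. -/
theorem concatP_xpar_coherence {Y : Type*} [TopologicalSpace Y]
    (α₁ α₂ α₃ : unitInterval → Y)
    (h₁ : Continuous α₁) (h₂ : Continuous α₂) (h₃ : Continuous α₃)
    (h₁₂ : α₁ 1 = α₂ 0) (h₂₃ : α₂ 1 = α₃ 0)
    (a₁ a₂ a₃ c : ℝ) (h0 : 0 < a₁) (h12 : a₁ < a₂) (h23 : a₂ < a₃) (h3c : a₃ < c) :
    concatP (concatP α₁ α₂ (xpar c a₁ a₂)) α₃ (xpar c a₂ a₃) =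
      concat₃ α₁ α₂ α₃ (xpar c a₁ a₃) (xpar c a₂ a₃) ∧
    concat₃ α₁ α₂ α₃ (xpar c a₁ a₃) (xpar c a₂ a₃) =
      concatP α₁ (concatP α₂ α₃ (xpar (c - a₁) (a₂ - a₁) (a₃ - a₁))) (xpar c a₁ a₃) := by
  have hx := xpar_lt_one h0 (h12.trans h23) h3c
  constructor
  · rw [concatP_concatP_left _ _ _ (xpar_lt_one h0 h12 (h23.trans h3c)).le
      (xpar_pos (h0.trans h12) h23 h3c),
      xpar_mul_xpar (h0.trans h12).ne' (h23.trans h3c).ne']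
  · rw [← xpar_sub_div_one_sub h0 h12 h23 h3c, concatP_concatP_right _ _ _ hx]
end
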